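/- arXiv:1302.6863 — 2 statements merged into one kernel-verified Lean document; each statement's English description precedes it below -/
import Mathlib

section
/- For every d ∈ ℕ and every function f : ℕ → ℝ there exists a constant c (depending only on d and f) with the following property: for every finite simple graph G with ∇_r(G) ≤ f(r) for all r ∈ ℕ and every S ⊆ V(G) with td(G − S) ≤ d, the vertex set V(G) can be partitioned into sets Y₀, Y₁, …, Y_ℓ (with Y₁,…,Y_ℓ nonempty) such that: (1) S ⊆ Y₀ and |Y₀| ≤ c·|S|; (2) for each 1 ≤ i ≤ ℓ, Yᵢ is a union of vertex sets of connected components of G − Y₀, all of these components have the same neighborhood in Y₀, and this common neighborhood has at most c vertices; (3) ℓ ≤ c·(|S| + 1). -/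
/-- `H` is a shallow minor of `G` at depth `d`. -/
def IsShallowMinorAtDepth {V W : Type*} (G : SimpleGraph V) (d : ℕ)
    (H : SimpleGraph W) : Prop :=
  ∃ ψ : W → Set V,
    (∀ w, (ψ w).Nonempty) ∧
    (∀ w₁ w₂, w₁ ≠ w₂ → Disjoint (ψ w₁) (ψ w₂)) ∧
    (∀ w, ∃ c : ψ w, ∀ u : ψ w,
      ∃ p : (SimpleGraph.induce (ψ w) G).Walk c u, p.length ≤ d) ∧
    (∀ w₁ w₂, w₁ ≠ w₂ →
      (H.Adj w₁ w₂ ↔ ∃ v₁ ∈ ψ w₁, ∃ v₂ ∈ ψ w₂, G.Adj v₁ v₂))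

/-- The greatest reduced average density (grad) of rank `d`. -/
noncomputable def grad {V : Type*} (G : SimpleGraph V) (d : ℕ) : ℝ :=
  sSup { q : ℝ | ∃ (n : ℕ) (H : SimpleGraph (Fin n)), 0 < n ∧
    IsShallowMinorAtDepth G d H ∧ q = (H.edgeSet.ncard : ℝ) / (n : ℝ) }

/-- `td(G) ≤ h`: there is a rooted forest on `V(G)` (given by a parent function together
with a consistent depth function) of height at most `h` such that every edge of `G`
joins two vertices in ancestor–descendant relation. -/
def treedepthLE {V : Type*} (G : SimpleGraph V) (h : ℕ) : Prop :=
  ∃ (par : V → V) (dep : V → ℕ),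
    (∀ v, (par v = v → dep v = 1) ∧ (par v ≠ v → dep v = dep (par v) + 1)) ∧
    (∀ v, dep v ≤ h) ∧
    (∀ u w, G.Adj u w → (∃ n, par^[n] w = u) ∨ (∃ n, par^[n] u = w))

/-- `N_S(C)`: vertices of `S` having at least one neighbor in `C`. -/
def nbrIn {V : Type*} (G : SimpleGraph V) (S C : Set V) : Set V :=
  {v ∈ S | ∃ u ∈ C, G.Adj v u}

/-- `C` is (the vertex set of) a connected component of `G − S`. -/
def IsCompOf {V : Type*} (G : SimpleGraph V) (S : Set V) (C : Set V) : Prop :=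
  C ⊆ Sᶜ ∧ C.Nonempty ∧ (SimpleGraph.induce C G).Connected ∧
    ∀ v ∈ Sᶜ, v ∉ C → ∀ u ∈ C, ¬ G.Adj u v

section PD
open scoped Classical

theorem pd_tool {V : Type} [Fintype V] (G : SimpleGraph V) (r m : ℕ) (hm : grad G r ≤ m)
    {W : Type} (A : Finset W) (ψ : W → Set V)
    (h1 : ∀ w ∈ A, (ψ w).Nonempty)
    (h2 : ∀ w₁ ∈ A, ∀ w₂ ∈ A, w₁ ≠ w₂ → Disjoint (ψ w₁) (ψ w₂))
    (h3 : ∀ w ∈ A, ∃ c : ψ w, ∀ u : ψ w,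
      ∃ p : (SimpleGraph.induce (ψ w) G).Walk c u, p.length ≤ r)
    (P : Finset (W × W))
    (hP : ∀ p ∈ P, p.1 ∈ A ∧ p.2 ∈ A ∧ p.1 ≠ p.2 ∧ ∃ v₁ ∈ ψ p.1, ∃ v₂ ∈ ψ p.2, G.Adj v₁ v₂) :
    P.card ≤ 2 * m * A.card := by
  let e := A.equivFin
  let H : SimpleGraph (Fin A.card) :=
    { Adj := fun i j => i ≠ j ∧ ∃ v₁ ∈ ψ (e.symm i), ∃ v₂ ∈ ψ (e.symm j), G.Adj v₁ v₂
      symm := ⟨fun i j ⟨h, v₁, a, v₂, b, c⟩ => ⟨h.symm, v₂, b, v₁, a, c.symm⟩⟩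
      loopless := ⟨fun i h => h.1 rfl⟩ }
  have hH : IsShallowMinorAtDepth G r H := by
    refine ⟨fun i => ψ (e.symm i), fun w => h1 _ (e.symm w).2, ?_, fun w => h3 _ (e.symm w).2, ?_⟩
    · intro a b hab
      apply h2 _ (e.symm a).2 _ (e.symm b).2
      intro h
      exact hab (e.symm.injective (Subtype.ext h))
    · intro a b hab
      exact ⟨fun h => h.2, fun h => ⟨hab, h⟩⟩
  have hdart : P.card ≤ Fintype.card H.Dart := by
    have : Fintype.card P ≤ Fintype.card H.Dart := by
      refine Fintype.card_le_of_injective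
        (fun p : P => (⟨(e ⟨p.1.1, (hP _ p.2).1⟩, e ⟨p.1.2, (hP _ p.2).2.1⟩), ?_⟩ : H.Dart)) ?_
      · obtain ⟨a, b, c, d⟩ := hP _ p.2
        refine ⟨?_, ?_⟩
        · intro h
          have := e.injective h
          exact c (congrArg Subtype.val this)
        · simpa using d
      · intro p q h
        simp only [SimpleGraph.Dart.mk.injEq, Prod.mk.injEq, EmbeddingLike.apply_eq_iff_eq,
          Subtype.mk.injEq] at h
        exact Subtype.ext (Prod.ext h.1 h.2)
    simpa using this
  rw [H.dart_card_eq_twice_card_edges] at hdart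
  rcases Nat.eq_zero_or_pos A.card with h0 | h0
  · have : P = ∅ := by
      apply Finset.eq_empty_of_forall_notMem
      intro p hp
      have := (hP p hp).1
      rw [Finset.card_eq_zero.mp h0] at this
      simp at this
    simp [this]
  have hle : (H.edgeSet.ncard : ℝ) / A.card ≤ m := by
    unfold grad at hm
    refine le_trans (le_csSup ?_ ?_) hm
    rotate_left
    · exact ⟨A.card, H, h0, hH, rfl⟩
    refine ⟨((Fintype.card V + 1) ^ 2 : ℕ), ?_⟩
    rintro q ⟨n, K, hn, ⟨φ, f1, f2, -, -⟩, rfl⟩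
    have hnV : n ≤ Fintype.card V := by
      choose g hg using f1
      have : Function.Injective g := by
        intro a b hab
        by_contra hne
        exact (Set.disjoint_left.mp (f2 a b hne)) (hg a) (hab ▸ hg b)
      simpa using Fintype.card_le_of_injective g this
    have hK : K.edgeSet.ncard ≤ (Fintype.card V + 1) ^ 2 := by
      have h := K.card_edgeFinset_le_card_choose_two
      rw [Fintype.card_fin] at h
      have h' : K.edgeSet.ncard = K.edgeFinset.card := by
        rw [← SimpleGraph.coe_edgeFinset, Set.ncard_coe_finset]
      rw [h']
      calc _ ≤ n.choose 2 := h
        _ ≤ n ^ 2 := Nat.choose_le_pow n 2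
        _ ≤ _ := Nat.pow_le_pow_left (by omega) 2
    have hn' : (1:ℝ) ≤ n := by exact_mod_cast hn
    calc (K.edgeSet.ncard : ℝ) / n ≤ K.edgeSet.ncard := div_le_self (by positivity) hn'
      _ ≤ _ := by exact_mod_cast hK
  rw [div_le_iff₀ (by exact_mod_cast h0)] at hle
  have h' : H.edgeSet.ncard = H.edgeFinset.card := by
    rw [← SimpleGraph.coe_edgeFinset, Set.ncard_coe_finset]
  have h4 : H.edgeSet.ncard ≤ m * A.card := by exact_mod_cast hle
  rw [h'] at h4
  calc P.card ≤ 2 * H.edgeFinset.card := hdart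
    _ ≤ 2 * (m * A.card) := by omega
    _ = _ := by ring

theorem pd_clique {W : Type} (K : Finset (W × W)) (m : ℕ) (n : ℕ) : ∀ (A : Finset W), A.card = n →
    (∀ B ⊆ A, (K.filter (fun p => p.1 ∈ B ∧ p.2 ∈ B)).card ≤ 2 * m * B.card) →
    (A.powerset.filter (fun Q => Q.Nonempty ∧ ∀ x ∈ Q, ∀ y ∈ Q, x ≠ y → (x, y) ∈ K)).card
      ≤ 4 ^ m * A.card := by
  induction n with
  | zero =>
    intro A hA _
    rw [Finset.card_eq_zero.mp hA]
    simp [Finset.filter_singleton]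
  | succ n ih =>
    intro A hA hK
    have hv : ∃ v ∈ A, (A.filter (fun y => (v, y) ∈ K)).card ≤ 2 * m := by
      by_contra! hcon
      have h := hK A subset_rfl
      have h2 : (K.filter (fun p => p.1 ∈ A ∧ p.2 ∈ A)).card
          = ∑ v ∈ A, (A.filter (fun y => (v, y) ∈ K)).card := by
        rw [← Finset.card_sigma]
        symm
        refine Finset.card_bij (fun p _ => (p.1, p.2)) ?_ ?_ ?_
        · rintro ⟨a, b⟩ hp
          simp only [Finset.mem_sigma, Finset.mem_filter] at hp ⊢
          tauto
        · rintro ⟨a, b⟩ _ ⟨c, d⟩ _ h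
          simp only [Prod.mk.injEq] at h
          simp [h.1, h.2]
        · rintro ⟨a, b⟩ hp
          simp only [Finset.mem_filter] at hp
          exact ⟨⟨a, b⟩, by simp [hp], rfl⟩
      have h3 : A.card • (2 * m + 1) ≤ ∑ v ∈ A, (A.filter (fun y => (v, y) ∈ K)).card :=
        Finset.card_nsmul_le_sum _ _ _ (fun v hv => hcon v hv)
      rw [← h2, smul_eq_mul] at h3
      have : 0 < A.card := by omega
      nlinarith
    obtain ⟨v, hvA, hv⟩ := hv
    have hc : (A.erase v).card = n := by rw [Finset.card_erase_of_mem hvA]; omega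
    have h1 := ih (A.erase v) hc (fun B hB => hK B (hB.trans (Finset.erase_subset _ _)))
    have hsub : (A.powerset.filter (fun Q => Q.Nonempty ∧ ∀ x ∈ Q, ∀ y ∈ Q, x ≠ y → (x, y) ∈ K)) ⊆
       ((A.erase v).powerset.filter
          (fun Q => Q.Nonempty ∧ ∀ x ∈ Q, ∀ y ∈ Q, x ≠ y → (x, y) ∈ K)) ∪
        ((A.filter (fun y => (v, y) ∈ K)).powerset.image (insert v)) := by
      intro Q hQ
      simp only [Finset.mem_filter, Finset.mem_powerset] at hQ
      obtain ⟨hQA, hne, hQ⟩ := hQ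
      rw [Finset.mem_union]
      by_cases hvQ : v ∈ Q
      · right
        rw [Finset.mem_image]
        refine ⟨Q.erase v, ?_, Finset.insert_erase hvQ⟩
        rw [Finset.mem_powerset]
        intro y hy
        rw [Finset.mem_erase] at hy
        rw [Finset.mem_filter]
        exact ⟨hQA hy.2, hQ v hvQ y hy.2 hy.1.symm⟩
      · left
        simp only [Finset.mem_filter, Finset.mem_powerset]
        exact ⟨Finset.subset_erase.mpr ⟨hQA, hvQ⟩, hne, hQ⟩
    have h5 : ((A.filter (fun y => (v, y) ∈ K)).powerset.image (insert v)).card ≤ 4 ^ m := by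
      refine Finset.card_image_le.trans ?_
      rw [Finset.card_powerset]
      calc _ ≤ 2 ^ (2 * m) := Nat.pow_le_pow_right (by norm_num) hv
        _ = 4 ^ m := by rw [pow_mul]; norm_num
    calc _ ≤ _ := Finset.card_le_card hsub
      _ ≤ _ := Finset.card_union_le _ _
      _ ≤ 4 ^ m * (A.erase v).card + 4 ^ m := by omega
      _ = _ := by rw [hc, hA]; ring

theorem pd_large {V : Type} [Fintype V] (G : SimpleGraph V) (r m : ℕ) (hm : grad G r ≤ m)
    (Y : Set V) (I : Finset (Set V))
    (hdY : ∀ C ∈ I, C ⊆ Yᶜ) (hne : ∀ C ∈ I, C.Nonempty)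
    (hdis : ∀ C ∈ I, ∀ D ∈ I, C ≠ D → Disjoint C D)
    (hrad : ∀ C ∈ I, ∀ c u : C, ∃ p : (SimpleGraph.induce C G).Walk c u, p.length ≤ r)
    (hbig : ∀ C ∈ I, 2 * m < (nbrIn G Y C).ncard) :
    I.card ≤ 2 * m * Y.ncard := by
  let A : Finset (V ⊕ Set V) := Y.toFinset.disjSum I
  let ψ : V ⊕ Set V → Set V := Sum.elim (fun v => {v}) id
  let P : Finset ((V ⊕ Set V) × (V ⊕ Set V)) :=
    (I.sigma (fun C => (nbrIn G Y C).toFinset)).image (fun q => (Sum.inl q.2, Sum.inr q.1))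
  have hPc : P.card = ∑ C ∈ I, (nbrIn G Y C).ncard := by
    rw [Finset.card_image_of_injective, Finset.card_sigma]
    · exact Finset.sum_congr rfl (fun C _ => (Set.ncard_eq_toFinset_card' _).symm)
    · rintro ⟨a, b⟩ ⟨c, d⟩ h
      simp only [Prod.mk.injEq, Sum.inl.injEq, Sum.inr.injEq] at h
      simp [h.1, h.2]
  have hAc : A.card = Y.ncard + I.card := by
    rw [Finset.card_disjSum, Set.ncard_eq_toFinset_card']
  have key : P.card ≤ 2 * m * A.card := by
    refine pd_tool G r m hm A ψ ?_ ?_ ?_ P ?_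
    · rintro (v | C) h
      · exact Set.singleton_nonempty v
      · exact hne C (by simpa [A] using h)
    · rintro (v | C) h (w | D) h' hn
      · simp only [ψ, Sum.elim_inl, Set.disjoint_singleton]
        exact fun h => hn (by rw [h])
      · have hv : v ∈ Y := by simpa [A] using h
        have hD := hdY D (by simpa [A] using h')
        simp only [ψ, Sum.elim_inl, Sum.elim_inr, Set.disjoint_singleton_left]
        exact fun h => hD h hv
      · have hv : w ∈ Y := by simpa [A] using h'
        have hD := hdY C (by simpa [A] using h)
        simp only [ψ, Sum.elim_inl, Sum.elim_inr, Set.disjoint_singleton_right]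
        exact fun h => hD h hv
      · exact hdis C (by simpa [A] using h) D (by simpa [A] using h') (fun h => hn (by rw [h]))
    · rintro (v | C) h
      · refine ⟨⟨v, rfl⟩, ?_⟩
        rintro ⟨u, hu⟩
        have hu' : u = v := hu
        subst hu'
        exact ⟨SimpleGraph.Walk.nil, by simp⟩
      · have hC : C ∈ I := by simpa [A] using h
        obtain ⟨c, hc⟩ := hne C hC
        exact ⟨⟨c, hc⟩, fun u => hrad C hC _ u⟩
    · intro p hp
      simp only [P, Finset.mem_image, Finset.mem_sigma, Set.mem_toFinset] at hp
      obtain ⟨⟨C, v⟩, ⟨hC, hv⟩, rfl⟩ := hp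
      obtain ⟨hvY, u, hu, huv⟩ := hv
      refine ⟨by simpa [A] using hvY, by simpa [A] using hC, by simp, v, rfl, u, hu, huv⟩
  have h3 : I.card • (2 * m + 1) ≤ ∑ C ∈ I, (nbrIn G Y C).ncard :=
    Finset.card_nsmul_le_sum _ _ _ (fun v hv => hbig v hv)
  rw [← hPc, smul_eq_mul] at h3
  rw [hAc] at key
  nlinarith

theorem pd_nbrs {V : Type} [Fintype V] (G : SimpleGraph V) (r m : ℕ) (hm : grad G (r + 1) ≤ m)
    (Y : Set V) (I : Finset (Set V))
    (hdY : ∀ C ∈ I, C ⊆ Yᶜ)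
    (hdis : ∀ C ∈ I, ∀ D ∈ I, C ≠ D → Disjoint C D)
    (hrad : ∀ C ∈ I, ∀ c u : C, ∃ p : (SimpleGraph.induce C G).Walk c u, p.length ≤ r) :
    (I.image (fun C => nbrIn G Y C)).card ≤ (2 * m + 4 ^ m) * Y.ncard + 1 := by
  let Φ : Finset (Finset ((V × V) × Set V)) :=
    Finset.univ.filter (fun M =>
      (∀ a ∈ M, ∀ b ∈ M, a.1 = b.1 → a = b) ∧ (∀ a ∈ M, ∀ b ∈ M, a.2 = b.2 → a = b) ∧
      (∀ a ∈ M, a.2 ∈ I ∧ a.1.1 ≠ a.1.2 ∧ a.1.1 ∈ nbrIn G Y a.2 ∧ a.1.2 ∈ nbrIn G Y a.2))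
  obtain ⟨M, hMΦ, hmax⟩ := Finset.exists_max_image Φ Finset.card ⟨∅, by simp [Φ]⟩
  have hM := hMΦ
  simp only [Φ, Finset.mem_filter, Finset.mem_univ, true_and] at hM
  obtain ⟨hM1, hM2, hM3⟩ := hM
  let K : Finset (V × V) := M.image Prod.fst
  have hmaxi : ∀ C ∈ I, (∀ a ∈ M, a.2 ≠ C) → ∀ x ∈ nbrIn G Y C, ∀ y ∈ nbrIn G Y C, x ≠ y →
      (x, y) ∈ K := by
    intro C hC hCM x hx y hy hxy
    by_contra hK
    have hK' : ∀ a ∈ M, a.1 ≠ (x, y) := by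
      intro a ha h
      exact hK (Finset.mem_image.mpr ⟨a, ha, h⟩)
    have hnot : ((x, y), C) ∉ M := fun h => hCM _ h rfl
    have := hmax (insert ((x, y), C) M) (by
      simp only [Φ, Finset.mem_filter, Finset.mem_univ, true_and, Finset.mem_insert]
      refine ⟨?_, ?_, ?_⟩
      · rintro a (rfl | ha) b (rfl | hb) h
        · rfl
        · exact absurd h.symm (hK' b hb)
        · exact absurd h (hK' a ha)
        · exact hM1 a ha b hb h
      · rintro a (rfl | ha) b (rfl | hb) h
        · rfl
        · exact absurd h.symm (hCM b hb)
        · exact absurd h (hCM a ha)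
        · exact hM2 a ha b hb h
      · rintro a (rfl | ha)
        · exact ⟨hC, hxy, hx, hy⟩
        · exact hM3 a ha)
    rw [Finset.card_insert_of_notMem hnot] at this
    omega
  let ψ : V → Set V := fun y => {v | v = y ∨ ∃ a ∈ M, a.1.1 = y ∧ v ∈ a.2}
  have hden : ∀ B ⊆ Y.toFinset, (K.filter (fun p => p.1 ∈ B ∧ p.2 ∈ B)).card ≤ 2 * m * B.card := by
    intro B hB
    have hBY : ∀ y ∈ B, y ∈ Y := fun y hy => by simpa using hB hy
    refine pd_tool G (r + 1) m hm B ψ ?_ ?_ ?_ _ ?_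
    · intro w _
      exact ⟨w, Or.inl rfl⟩
    · intro y hy z hz hyz
      rw [Set.disjoint_left]
      rintro v (rfl | ⟨a, ha, rfl, hva⟩) (h | ⟨b, hb, h, hvb⟩)
      · exact hyz h
      · exact hdY _ (hM3 b hb).1 hvb (hBY _ hy)
      · subst h
        exact hdY _ (hM3 a ha).1 hva (hBY _ hz)
      · by_cases hab : a.2 = b.2
        · have := hM2 a ha b hb hab
          subst this
          exact hyz h
        · exact Set.disjoint_left.mp (hdis _ (hM3 a ha).1 _ (hM3 b hb).1 hab) hva hvb
    · intro y hy
      refine ⟨⟨y, Or.inl rfl⟩, ?_⟩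
      rintro ⟨u, (rfl | ⟨a, ha, rfl, hu⟩)⟩
      · exact ⟨SimpleGraph.Walk.nil, by simp⟩
      · obtain ⟨haI, -, ⟨-, w, hw, hyw⟩, -⟩ := hM3 a ha
        obtain ⟨p, hp⟩ := hrad a.2 haI ⟨w, hw⟩ ⟨u, hu⟩
        have hsub : a.2 ≤ ψ a.1.1 := fun v hv => Or.inr ⟨a, ha, rfl, hv⟩
        obtain ⟨q, hq⟩ : ∃ q : (SimpleGraph.induce (ψ a.1.1) G).Walk ⟨w, hsub hw⟩ ⟨u, hsub hu⟩,
            q.length = p.length :=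
          ⟨p.map (SimpleGraph.induceHomOfLE G hsub).toHom, SimpleGraph.Walk.length_map _ _⟩
        have hadj : (SimpleGraph.induce (ψ a.1.1) G).Adj ⟨a.1.1, Or.inl rfl⟩ ⟨w, hsub hw⟩ := hyw
        refine ⟨SimpleGraph.Walk.cons hadj q, ?_⟩
        rw [SimpleGraph.Walk.length_cons]
        omega
    · intro p hp
      simp only [Finset.mem_filter, K, Finset.mem_image] at hp
      obtain ⟨⟨a, ha, rfl⟩, h1, h2⟩ := hp
      obtain ⟨haI, hne, -, ⟨-, w, hw, hyw⟩⟩ := hM3 a ha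
      exact ⟨h1, h2, hne, w, Or.inr ⟨a, ha, rfl, hw⟩, a.1.2, Or.inl rfl, hyw.symm⟩
  have hMK : M.card = K.card := by
    rw [Finset.card_image_of_injOn]
    intro a ha b hb h
    exact hM1 a ha b hb h
  have hKc : K.card ≤ 2 * m * Y.ncard := by
    have h := hden _ subset_rfl
    rw [Finset.filter_true_of_mem] at h
    · rwa [Set.ncard_eq_toFinset_card']
    · intro p hp
      obtain ⟨a, ha, rfl⟩ := Finset.mem_image.mp hp
      obtain ⟨-, -, ⟨h1, -⟩, ⟨h2, -⟩⟩ := hM3 a ha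
      simp [h1, h2]
  obtain ⟨Q, hQ⟩ : ∃ Q, Q = (Y.toFinset.powerset.filter
    (fun Q => Q.Nonempty ∧ ∀ x ∈ Q, ∀ y ∈ Q, x ≠ y → (x, y) ∈ K)) := ⟨_, rfl⟩
  have hcl : Q.card ≤ 4 ^ m * Y.toFinset.card := by
    rw [hQ]
    convert pd_clique K m _ Y.toFinset rfl hden
  have hsub : I.image (fun C => nbrIn G Y C) ⊆
      (M.image (fun a => nbrIn G Y a.2) ∪ Q.image (fun s : Finset V => (s : Set V))) ∪ {∅} := by
    intro N hN
    obtain ⟨C, hC, rfl⟩ := Finset.mem_image.mp hN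
    simp only [Finset.mem_union, Finset.mem_singleton]
    by_cases h0 : nbrIn G Y C = ∅
    · exact Or.inr h0
    left
    by_cases hCM : ∀ a ∈ M, a.2 ≠ C
    · right
      rw [Finset.mem_image]
      refine ⟨(nbrIn G Y C).toFinset, ?_, by simp⟩
      rw [hQ, Finset.mem_filter, Finset.mem_powerset]
      refine ⟨?_, ?_, ?_⟩
      · intro v hv
        rw [Set.mem_toFinset] at hv ⊢
        exact hv.1
      · rw [Set.toFinset_nonempty]
        exact Set.nonempty_iff_ne_empty.mpr h0
      · intro x hx y hy
        rw [Set.mem_toFinset] at hx hy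
        exact hmaxi C hC hCM x hx y hy
    · push Not at hCM
      obtain ⟨a, ha, rfl⟩ := hCM
      left
      exact Finset.mem_image.mpr ⟨a, ha, rfl⟩
  have hYc : Y.toFinset.card = Y.ncard := (Set.ncard_eq_toFinset_card' _).symm
  rw [hYc] at hcl
  have e1 := Finset.card_le_card hsub
  have e2 := Finset.card_union_le (M.image (fun a => nbrIn G Y a.2) ∪ Q.image (fun s : Finset V => (s : Set V))) {∅}
  have e3 := Finset.card_union_le (M.image (fun a => nbrIn G Y a.2)) (Q.image (fun s : Finset V => (s : Set V)))
  have e4 : (M.image (fun a => nbrIn G Y a.2)).card ≤ M.card := Finset.card_image_le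
  have e5 : (Q.image (fun s : Finset V => (s : Set V))).card ≤ Q.card := Finset.card_image_le
  rw [Finset.card_singleton] at e2
  rw [add_mul]
  omega

structure PDTD {V : Type} (G : SimpleGraph V) (S : Set V) (d : ℕ) (A : V → V → Prop)
    (dep : V → ℕ) : Prop where
  refl : ∀ v, v ∉ S → A v v
  trans : ∀ u v w, A u v → A v w → A u w
  comp : ∀ u v w, A u w → A v w → A u v ∨ A v u
  lt : ∀ u v, A u v → u ≠ v → dep u < dep v
  adj : ∀ u v, u ∉ S → v ∉ S → G.Adj u v → A u v ∨ A v u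
  pos : ∀ v, v ∉ S → 0 < dep v
  le : ∀ v, v ∉ S → dep v ≤ d

theorem pd_td {V : Type} (G : SimpleGraph V) (S : Set V) (d : ℕ)
    (h : treedepthLE (SimpleGraph.induce Sᶜ G) d) : ∃ A dep, PDTD G S d A dep := by
  obtain ⟨par, dep, h1, h2, h3⟩ := h
  have hlt : ∀ n (v : ↥Sᶜ), par^[n] v ≠ v → dep (par^[n] v) < dep v := by
    intro n
    induction n with
    | zero => intro v h; exact absurd rfl h
    | succ n ih =>
      intro v h
      rw [Function.iterate_succ_apply] at h ⊢
      by_cases hv : par v = v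
      · rw [hv] at h ⊢
        exact ih v h
      · have := (h1 v).2 hv
        by_cases h' : par^[n] (par v) = par v
        · rw [h']; omega
        · have := ih _ h'
          omega
  refine ⟨fun v u => ∃ (hv : v ∈ Sᶜ) (hu : u ∈ Sᶜ) (n : ℕ), par^[n] ⟨u, hu⟩ = ⟨v, hv⟩,
    fun v => if h : v ∈ Sᶜ then dep ⟨v, h⟩ else 0, ?_⟩
  constructor
  · intro v hv
    exact ⟨hv, hv, 0, rfl⟩
  · rintro u v w ⟨hu, hv, n, hn⟩ ⟨_, hw, k, hk⟩
    refine ⟨hu, hw, n + k, ?_⟩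
    rw [Function.iterate_add_apply, hk, hn]
  · rintro u v w ⟨hu, hw, n, hn⟩ ⟨hv, _, k, hk⟩
    rcases le_total n k with h | h
    · right
      refine ⟨hv, hu, k - n, ?_⟩
      rw [← hn, ← Function.iterate_add_apply, Nat.sub_add_cancel h, hk]
    · left
      refine ⟨hu, hv, n - k, ?_⟩
      rw [← hk, ← Function.iterate_add_apply, Nat.sub_add_cancel h, hn]
  · rintro u v ⟨hu, hv, n, hn⟩ hne
    simp only [hu, hv, dif_pos]
    rw [← hn]
    apply hlt
    rw [hn]
    intro h
    exact hne (congrArg Subtype.val h)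
  · intro u v hu hv huv
    rcases h3 ⟨u, hu⟩ ⟨v, hv⟩ huv with ⟨n, hn⟩ | ⟨n, hn⟩
    · exact Or.inl ⟨hu, hv, n, hn⟩
    · exact Or.inr ⟨hv, hu, n, hn⟩
  · intro v hv
    have hv' : v ∈ Sᶜ := hv
    simp only [hv', dif_pos]
    by_cases h : par ⟨v, hv'⟩ = ⟨v, hv'⟩
    · rw [(h1 _).1 h]; omega
    · rw [(h1 _).2 h]; omega
  · intro v hv
    have hv' : v ∈ Sᶜ := hv
    simp only [hv', dif_pos]
    exact h2 _

theorem pd_walkroot {V : Type} {G : SimpleGraph V} {S : Set V} {d : ℕ} {A : V → V → Prop}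
    {dep : V → ℕ} (T : PDTD G S d A dep) {a b : V} (p : G.Walk a b)
    (hp : ∀ v ∈ p.support, v ∉ S) : ∃ v ∈ p.support, ∀ u ∈ p.support, A v u := by
  induction p with
  | nil =>
    rename_i u
    refine ⟨u, by simp, ?_⟩
    intro w hw
    simp only [SimpleGraph.Walk.support_nil, List.mem_singleton] at hw
    subst hw
    exact T.refl _ (hp _ (by simp))
  | cons h q ih =>
    rename_i u w x
    have hq : ∀ v ∈ q.support, v ∉ S := fun v hv => hp v (by simp [hv])
    obtain ⟨v, hv, hall⟩ := ih hq
    have hu : u ∉ S := hp u (by simp)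
    have hw : w ∈ q.support := q.start_mem_support
    have hcase : A u v ∨ A v u := by
      rcases T.adj u w hu (hq w hw) h with h1 | h1
      · exact T.comp _ _ _ h1 (hall w hw)
      · exact Or.inr (T.trans _ _ _ (hall w hw) h1)
    simp only [SimpleGraph.Walk.support_cons, List.mem_cons]
    rcases hcase with h1 | h1
    · refine ⟨u, Or.inl rfl, ?_⟩
      rintro z (rfl | hz)
      · exact T.refl _ hu
      · exact T.trans _ _ _ h1 (hall z hz)
    · refine ⟨v, Or.inr hv, ?_⟩
      rintro z (rfl | hz)
      · exact h1
      · exact hall z hz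

theorem pd_pathlen {V : Type} {G : SimpleGraph V} {S : Set V} {d : ℕ} {A : V → V → Prop}
    {dep : V → ℕ} (T : PDTD G S d A dep) (j : ℕ) : ∀ {a b : V} (p : G.Walk a b), p.IsPath →
    (∀ v ∈ p.support, v ∉ S) → (∀ v ∈ p.support, d < dep v + j) → p.length + 2 ≤ 2 ^ j := by
  induction j with
  | zero =>
    intro a b p _ h1 h2
    have := h2 a p.start_mem_support
    have := T.le a (h1 a p.start_mem_support)
    omega
  | succ j ih =>
    intro a b p hp h1 h2
    obtain ⟨v, hv, hall⟩ := pd_walkroot T p h1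
    have half : ∀ {c : V} (q : G.Walk v c), q.IsPath → (∀ u ∈ q.support, u ∈ p.support) →
        q.length + 1 ≤ 2 ^ j := by
      intro c q hq hqs
      cases q with
      | nil => simpa using Nat.one_le_two_pow
      | cons h q =>
        rw [SimpleGraph.Walk.cons_isPath_iff] at hq
        rw [SimpleGraph.Walk.length_cons]
        have hs : ∀ u ∈ q.support, u ∈ p.support := fun u hu => hqs u (by simp [hu])
        refine ih q hq.1 (fun u hu => h1 u (hs u hu)) ?_
        intro u hu
        have hne : v ≠ u := by
          rintro rfl
          exact hq.2 hu
        have := T.lt v u (hall u (hs u hu)) hne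
        have := h2 v hv
        omega
    obtain ⟨q, r, hq, hr, rfl⟩ := hp.mem_support_iff_exists_append.mp hv
    have e1 := half r hr (fun u hu => by
      rw [SimpleGraph.Walk.mem_support_append_iff]; exact Or.inr hu)
    have e2 := half q.reverse hq.reverse (fun u hu => by
      rw [SimpleGraph.Walk.mem_support_append_iff]
      left
      simpa using hu)
    rw [SimpleGraph.Walk.length_reverse] at e2
    rw [SimpleGraph.Walk.length_append, pow_succ]
    omega

theorem pd_supp {V : Type} {G : SimpleGraph V} {C : Set V} {a b : C}
    (p : (SimpleGraph.induce C G).Walk a b) :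
    ∀ v ∈ (p.map (SimpleGraph.Embedding.induce C).toHom).support, v ∈ C := by
  intro v hv
  rw [SimpleGraph.Walk.support_map, List.mem_map] at hv
  obtain ⟨x, _, rfl⟩ := hv
  exact x.2

theorem pd_rad {V : Type} {G : SimpleGraph V} {S : Set V} {d : ℕ} {A : V → V → Prop}
    {dep : V → ℕ} (T : PDTD G S d A dep) {C : Set V} (hC : C ⊆ Sᶜ)
    (hcon : (SimpleGraph.induce C G).Connected) (c u : C) :
    ∃ p : (SimpleGraph.induce C G).Walk c u, p.length ≤ 2 ^ d := by
  obtain ⟨p, hp⟩ := (hcon.preconnected c u).exists_isPath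
  refine ⟨p, ?_⟩
  have h := pd_pathlen T d (p.map (SimpleGraph.Embedding.induce C).toHom)
    (SimpleGraph.Walk.IsPath.map (f := (SimpleGraph.Embedding.induce C).toHom)
      (SimpleGraph.Embedding.induce (G := G) C).injective hp)
    (fun v hv => hC (pd_supp p v hv))
    (fun v hv => by
      have := T.pos v (hC (pd_supp p v hv))
      omega)
  rw [SimpleGraph.Walk.length_map] at h
  omega

theorem pd_root {V : Type} {G : SimpleGraph V} {S : Set V} {d : ℕ} {A : V → V → Prop}
    {dep : V → ℕ} (T : PDTD G S d A dep) {C : Set V} (hC : C ⊆ Sᶜ) (hne : C.Nonempty)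
    (hcon : (SimpleGraph.induce C G).Connected) : ∃ r ∈ C, ∀ u ∈ C, A r u := by
  obtain ⟨r, hr, hmin⟩ : ∃ r ∈ C, ∀ u ∈ C, dep r ≤ dep u := by
    obtain ⟨n, ⟨r, hr, rfl⟩, hn⟩ :=
      WellFounded.has_min (wellFounded_lt (α := ℕ)) (dep '' C) (hne.image dep)
    exact ⟨r, hr, fun u hu => not_lt.mp (hn _ ⟨u, hu, rfl⟩)⟩
  refine ⟨r, hr, fun u hu => ?_⟩
  obtain ⟨p⟩ := hcon.preconnected ⟨r, hr⟩ ⟨u, hu⟩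
  obtain ⟨v, hv, hall⟩ := pd_walkroot T (p.map (SimpleGraph.Embedding.induce C).toHom)
    (fun v hv => hC (pd_supp p v hv))
  have hvC := pd_supp p v hv
  have h1 : A v r := hall r (SimpleGraph.Walk.start_mem_support _)
  have h2 : A v u := hall u (SimpleGraph.Walk.end_mem_support _)
  by_cases hvr : v = r
  · rwa [← hvr]
  · have := T.lt _ _ h1 hvr
    have := hmin v hvC
    omega

theorem pd_L1 {V : Type} {G : SimpleGraph V} {Y B C : Set V} (hB : B ⊆ Yᶜ)
    (hcon : (SimpleGraph.induce B G).Connected) (hC : IsCompOf G Y C) {v : V} (hvB : v ∈ B)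
    (hvC : v ∈ C) : B ⊆ C := by
  intro u hu
  obtain ⟨p⟩ := hcon.preconnected ⟨v, hvB⟩ ⟨u, hu⟩
  have : ∀ (a b : B), (SimpleGraph.induce B G).Walk a b → a.1 ∈ C → b.1 ∈ C := by
    intro a b p
    induction p with
    | nil => exact id
    | cons h q ih =>
      rename_i x y z
      intro hx
      apply ih
      by_contra hy
      exact hC.2.2.2 y (hB y.2) hy x hx h
  exact this _ _ p hvC

theorem pd_comp_eq {V : Type} {G : SimpleGraph V} {Y C D : Set V} (hC : IsCompOf G Y C)
    (hD : IsCompOf G Y D) {v : V} (h1 : v ∈ C) (h2 : v ∈ D) : C = D :=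
  Set.Subset.antisymm (pd_L1 hC.1 hC.2.2.1 hD h1 h2) (pd_L1 hD.1 hD.2.2.1 hC h2 h1)

theorem pd_comp_dis {V : Type} {G : SimpleGraph V} {Y C D : Set V} (hC : IsCompOf G Y C)
    (hD : IsCompOf G Y D) (h : C ≠ D) : Disjoint C D :=
  Set.disjoint_left.mpr (fun _ h1 h2 => h (pd_comp_eq hC hD h1 h2))

theorem pd_comp_exists {V : Type} (G : SimpleGraph V) (Y : Set V) {v : V} (hv : v ∉ Y) :
    ∃ C, IsCompOf G Y C ∧ v ∈ C := by
  let H := SimpleGraph.induce Yᶜ G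
  let C : Set V := {u | ∃ hu : u ∈ Yᶜ, H.Reachable ⟨v, hv⟩ ⟨u, hu⟩}
  have hvC : v ∈ C := ⟨hv, SimpleGraph.Reachable.refl _⟩
  have step : ∀ (a b : ↥Yᶜ), H.Walk a b → ∀ (ha : a.1 ∈ C), ∃ hb : b.1 ∈ C,
      (SimpleGraph.induce C G).Reachable ⟨a.1, ha⟩ ⟨b.1, hb⟩ := by
    intro a b p
    induction p with
    | nil => exact fun ha => ⟨ha, SimpleGraph.Reachable.refl _⟩
    | cons h q ih =>
      rename_i x y z
      intro hx
      have hy : y.1 ∈ C := ⟨y.2, hx.2.trans h.reachable⟩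
      obtain ⟨hz, hr⟩ := ih hy
      refine ⟨hz, SimpleGraph.Reachable.trans ?_ hr⟩
      have : (SimpleGraph.induce C G).Adj ⟨x.1, hx⟩ ⟨y.1, hy⟩ := h
      exact this.reachable
  refine ⟨C, ⟨fun u hu => hu.1, ⟨v, hvC⟩, ?_, ?_⟩, hvC⟩
  · have hr : ∀ u : C, (SimpleGraph.induce C G).Reachable ⟨v, hvC⟩ u := by
      rintro ⟨u, hu⟩
      obtain ⟨p⟩ := hu.2
      exact (step _ _ p hvC).2
    have : Nonempty C := ⟨⟨v, hvC⟩⟩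
    exact ⟨fun a b => (hr a).symm.trans (hr b)⟩
  · intro w hw hwC u hu huw
    apply hwC
    refine ⟨hw, hu.2.trans ?_⟩
    have : H.Adj ⟨u, hu.1⟩ ⟨w, hw⟩ := huw
    exact this.reachable

theorem pd_step {V : Type} [Fintype V] {G : SimpleGraph V} {S : Set V} {d m : ℕ}
    {A : V → V → Prop} {dep : V → ℕ} (T : PDTD G S d A dep) (hm : grad G (2 ^ d) ≤ m)
    (k : ℕ) : ∃ Y : Set V, S ⊆ Y ∧ Y.ncard ≤ (1 + 2 * m) ^ k * S.ncard ∧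
      ∀ C, IsCompOf G Y C → 2 * m < (nbrIn G Y C).ncard → ∀ u ∈ C, k < dep u := by
  induction k with
  | zero =>
    refine ⟨S, subset_rfl, by simp, ?_⟩
    intro C hC _ u hu
    exact T.pos u (hC.1 hu)
  | succ k ih =>
    obtain ⟨Y, hSY, hcard, hinv⟩ := ih
    let L : Finset (Set V) :=
      Finset.univ.filter (fun C => IsCompOf G Y C ∧ 2 * m < (nbrIn G Y C).ncard)
    have hL : ∀ C, C ∈ L ↔ IsCompOf G Y C ∧ 2 * m < (nbrIn G Y C).ncard := by simp [L]
    have hYS : Yᶜ ⊆ Sᶜ := Set.compl_subset_compl.mpr hSY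
    have hLc : L.card ≤ 2 * m * Y.ncard := by
      refine pd_large G (2 ^ d) m hm Y L ?_ ?_ ?_ ?_ ?_
      · exact fun C hC => ((hL C).1 hC).1.1
      · exact fun C hC => ((hL C).1 hC).1.2.1
      · exact fun C hC D hD h => pd_comp_dis ((hL C).1 hC).1 ((hL D).1 hD).1 h
      · exact fun C hC => pd_rad T (((hL C).1 hC).1.1.trans hYS) ((hL C).1 hC).1.2.2.1
      · exact fun C hC => ((hL C).1 hC).2
    have hroot : ∀ C : L, ∃ r : V, r ∈ C.1 ∧ ∀ u ∈ C.1, A r u := by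
      intro C
      have hc := ((hL C.1).1 C.2).1
      exact pd_root T (hc.1.trans hYS) hc.2.1 hc.2.2.1
    choose r hr1 hr2 using hroot
    refine ⟨Y ∪ Set.range r, hSY.trans Set.subset_union_left, ?_, ?_⟩
    · have e1 := Set.ncard_union_le Y (Set.range r)
      have e2 : (Set.range r).ncard ≤ L.card := by
        rw [← Set.image_univ]
        refine (Set.ncard_image_le Set.finite_univ).trans ?_
        rw [Set.ncard_univ]
        simp
      calc _ ≤ (1 + 2 * m) * Y.ncard := by rw [add_mul]; omega
        _ ≤ (1 + 2 * m) * ((1 + 2 * m) ^ k * S.ncard) := Nat.mul_le_mul_left _ hcard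
        _ = _ := by ring
    · intro C' hC' hbig u hu
      have hC'Y : C' ⊆ Yᶜ := fun x hx hxY => hC'.1 hx (Or.inl hxY)
      obtain ⟨C, hC, huC⟩ := pd_comp_exists G Y (hC'Y hu)
      have hsub : C' ⊆ C := pd_L1 hC'Y hC'.2.2.1 hC hu huC
      by_cases hCL : C ∈ L
      · have hk := hinv C hC ((hL C).1 hCL).2 (r ⟨C, hCL⟩) (hr1 ⟨C, hCL⟩)
        have := T.lt _ _ (hr2 ⟨C, hCL⟩ u huC) (by
          intro h
          exact hC'.1 hu (Or.inr ⟨_, h⟩))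
        omega
      · exfalso
        have hCY' : C ⊆ (Y ∪ Set.range r)ᶜ := by
          rintro x hx (hxY | ⟨D, rfl⟩)
          · exact hC.1 hx hxY
          · have := pd_comp_eq hC ((hL D.1).1 D.2).1 hx (hr1 D)
            exact hCL (this ▸ D.2)
        have hsub' : C ⊆ C' := pd_L1 hCY' hC.2.2.1 hC' huC hu
        have hEq : C' = C := Set.Subset.antisymm hsub hsub'
        subst hEq
        apply hCL
        rw [hL]
        refine ⟨hC, hbig.trans_le (Set.ncard_le_ncard ?_ (Set.toFinite _))⟩
        rintro v ⟨hv, w, hw, hvw⟩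
        refine ⟨?_, w, hw, hvw⟩
        by_contra hvY
        by_cases hvC : v ∈ C'
        · exact hCY' hvC hv
        · exact hC.2.2.2 v hvY hvC w hw hvw.symm

end PD

/-- For every `d` and every expansion bound `f` there is a constant `c` such that for
every graph `G` with `∇_r(G) ≤ f(r)` for all `r` and every treedepth-`d` modulator `S`,
the vertex set can be partitioned into `Y₀, Y₁, …, Y_ℓ` with `S ⊆ Y₀`, `|Y₀| ≤ c·|S|`,
each `Yᵢ` (`i ≥ 1`) nonempty and a union of connected components of `G − Y₀` that all
share one neighborhood in `Y₀` of at most `c` vertices, and `ℓ ≤ c·(|S| + 1)`. -/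
theorem protrusion_decomposition_bounded_expansion (d : ℕ) (f : ℕ → ℝ) :
    ∃ c : ℕ, ∀ (V : Type) [Fintype V] (G : SimpleGraph V) (S : Set V),
      (∀ r : ℕ, grad G r ≤ f r) →
      treedepthLE (SimpleGraph.induce Sᶜ G) d →
      ∃ (ℓ : ℕ) (Y : Fin (ℓ + 1) → Set V),
        (∀ i j, i ≠ j → Disjoint (Y i) (Y j)) ∧
        (⋃ i, Y i) = Set.univ ∧
        S ⊆ Y 0 ∧ (Y 0).ncard ≤ c * S.ncard ∧
        (∀ i, i ≠ 0 → (Y i).Nonempty ∧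
          ∃ N : Set V, N ⊆ Y 0 ∧ N.ncard ≤ c ∧
            ∃ 𝒟 : Set (Set V),
              (∀ C ∈ 𝒟, IsCompOf G (Y 0) C ∧ nbrIn G (Y 0) C = N) ∧
              Y i = ⋃₀ 𝒟) ∧
        ℓ ≤ c * (S.ncard + 1) := by
  classical
  obtain ⟨m, hm1, hm2⟩ : ∃ m : ℕ, f (2 ^ d) ≤ m ∧ f (2 ^ d + 1) ≤ m := by
    obtain ⟨m, hm⟩ := exists_nat_ge (max (f (2 ^ d)) (f (2 ^ d + 1)))
    exact ⟨m, (le_max_left _ _).trans hm, (le_max_right _ _).trans hm⟩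
  refine ⟨(2 * m + 4 ^ m + 1) * (1 + 2 * m) ^ d + 2 * m, ?_⟩
  intro V _ G S hG hS
  obtain ⟨A, dep, T⟩ := pd_td G S d hS
  obtain ⟨Y, hSY, hYc, hinv⟩ := pd_step T ((hG _).trans hm1) d
  have hYS : Yᶜ ⊆ Sᶜ := Set.compl_subset_compl.mpr hSY
  have hsmall : ∀ C, IsCompOf G Y C → (nbrIn G Y C).ncard ≤ 2 * m := by
    intro C hC
    by_contra! h
    obtain ⟨u, hu⟩ := hC.2.1
    have h1 := hinv C hC h u hu
    have h2 := T.le u (hYS (hC.1 hu))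
    omega
  let I : Finset (Set V) := Finset.univ.filter (fun C => IsCompOf G Y C)
  have hI : ∀ C, C ∈ I ↔ IsCompOf G Y C := by simp [I]
  have hcount : (I.image (fun C => nbrIn G Y C)).card ≤ (2 * m + 4 ^ m) * Y.ncard + 1 := by
    convert pd_nbrs G (2 ^ d) m ((hG _).trans hm2) Y I
      (fun C hC => ((hI C).1 hC).1)
      (fun C hC D hD h => pd_comp_dis ((hI C).1 hC) ((hI D).1 hD) h)
      (fun C hC => pd_rad T (((hI C).1 hC).1.trans hYS) ((hI C).1 hC).2.2.1)
  obtain ⟨N, hN⟩ : ∃ N, N = I.image (fun C => nbrIn G Y C) := ⟨_, rfl⟩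
  rw [← hN] at hcount
  let e := N.equivFin
  let Z : Fin N.card → Set V := fun i =>
    ⋃₀ {C | IsCompOf G Y C ∧ nbrIn G Y C = (e.symm i).1}
  refine ⟨N.card, Fin.cons Y Z, ?_, ?_, ?_, ?_, ?_, ?_⟩
  · have h0 : ∀ i, Disjoint Y (Z i) := by
      intro i
      rw [Set.disjoint_left]
      rintro v hv ⟨C, ⟨hC, -⟩, hvC⟩
      exact hC.1 hvC hv
    intro i j
    refine Fin.cases ?_ (fun i => ?_) i <;> refine Fin.cases ?_ (fun j => ?_) j
    · intro h; exact absurd rfl h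
    · intro _; simpa using h0 j
    · intro _; simpa using (h0 i).symm
    · intro hij
      simp only [Fin.cons_succ]
      rw [Set.disjoint_left]
      rintro v ⟨C, ⟨hC, hCi⟩, hvC⟩ ⟨D, ⟨hD, hDj⟩, hvD⟩
      have := pd_comp_eq hC hD hvC hvD
      subst this
      apply hij
      have := e.symm.injective (Subtype.ext (hCi.symm.trans hDj))
      rw [this]
  · rw [Set.eq_univ_iff_forall]
    intro v
    rw [Set.mem_iUnion]
    by_cases hv : v ∈ Y
    · exact ⟨0, by simpa using hv⟩
    · obtain ⟨C, hC, hvC⟩ := pd_comp_exists G Y hv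
      have hmem : nbrIn G Y C ∈ N := by
        rw [hN]
        exact Finset.mem_image.mpr ⟨C, (hI C).2 hC, rfl⟩
      refine ⟨(e ⟨_, hmem⟩).succ, ?_⟩
      simp only [Fin.cons_succ]
      exact ⟨C, ⟨hC, by simp⟩, hvC⟩
  · simpa using hSY
  · simp only [Fin.cons_zero]
    refine hYc.trans (Nat.mul_le_mul_right _ ?_)
    nlinarith [Nat.zero_le ((2 * m + 4 ^ m) * (1 + 2 * m) ^ d)]
  · intro i
    refine Fin.cases ?_ (fun i => ?_) i
    · intro h; exact absurd rfl h
    · intro _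
      simp only [Fin.cons_succ, Fin.cons_zero]
      have hmem := (e.symm i).2
      obtain ⟨C, hC, hCN⟩ := Finset.mem_image.mp (hN.le hmem)
      have hC := (hI C).1 hC
      refine ⟨?_, (e.symm i).1, ?_, ?_, _, ?_, rfl⟩
      · obtain ⟨v, hv⟩ := hC.2.1
        exact ⟨v, C, ⟨hC, hCN⟩, hv⟩
      · rw [← hCN]
        exact fun v hv => hv.1
      · rw [← hCN]
        exact (hsmall C hC).trans (Nat.le_add_left _ _)
      · exact fun D hD => hD
  · have h1 : (2 * m + 4 ^ m) * Y.ncard ≤ (2 * m + 4 ^ m) * ((1 + 2 * m) ^ d * S.ncard) :=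
      Nat.mul_le_mul_left _ hYc
    have h2 : 1 ≤ (1 + 2 * m) ^ d := Nat.one_le_pow _ _ (by omega)
    have h3 : 1 ≤ 4 ^ m := Nat.one_le_pow _ _ (by omega)
    generalize (1 + 2 * m) ^ d = P at *
    generalize 4 ^ m = Q at *
    generalize S.ncard = s at *
    have h4 : ((2 * m + Q + 1) * P + 2 * m) * (s + 1)
      = (2 * m + Q) * (P * s) + P * s + (2 * m + Q) * P + P + 2 * m * (s + 1) := by ring
    rw [h4]
    have := Nat.zero_le (P * s)
    have := Nat.zero_le ((2 * m + Q) * P)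
    have := Nat.zero_le (2 * m * (s + 1))
    linarith
end

section
/- For all t, d ∈ ℕ, the Longest Cycle problem has finite integer index on graphs of treedepth at most d: there exists a finite set 𝓡 of t-boundaried graphs such that every t-boundaried graph G whose underlying graph has treedepth at most d satisfies G ≡_{LC,t} R for some R ∈ 𝓡. -/
/-- A `t`-boundaried graph: a finite simple graph with `t` distinguished vertices
labeled injectively by `1,…,t`. -/
structure BGraph (t : ℕ) : Type 1 where
  V : Type
  fin : Fintype V
  G : SimpleGraph V
  b : Fin t → V
  binj : Function.Injective b

/-- The underlying relation of the glued graph `G₁ ⊕ G₂`. -/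
def glueAdj {t : ℕ} (G₁ G₂ : BGraph t) :
    G₁.V ⊕ {v : G₂.V // v ∉ Set.range G₂.b} →
    G₁.V ⊕ {v : G₂.V // v ∉ Set.range G₂.b} → Prop
  | Sum.inl u, Sum.inl v =>
      G₁.G.Adj u v ∨ ∃ i j, u = G₁.b i ∧ v = G₁.b j ∧ G₂.G.Adj (G₂.b i) (G₂.b j)
  | Sum.inl u, Sum.inr v => ∃ i, u = G₁.b i ∧ G₂.G.Adj (G₂.b i) v.1
  | Sum.inr _, Sum.inl _ => False
  | Sum.inr u, Sum.inr v => G₂.G.Adj u.1 v.1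

/-- The glued graph `G₁ ⊕ G₂`. -/
def glue {t : ℕ} (G₁ G₂ : BGraph t) :
    SimpleGraph (G₁.V ⊕ {v : G₂.V // v ∉ Set.range G₂.b}) :=
  SimpleGraph.fromRel (glueAdj G₁ G₂)

/-- `G` contains a simple cycle with at least `ℓ` edges. -/
def HasCycleGE {W : Type*} (G : SimpleGraph W) (ℓ : ℤ) : Prop :=
  ∃ (u : W) (p : G.Walk u u), p.IsCycle ∧ ℓ ≤ (p.length : ℤ)

/-- Equivalence of `t`-boundaried graphs for the Longest Cycle problem. -/
def LCEquiv {t : ℕ} (G₁ G₂ : BGraph t) : Prop :=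
  ∃ Δ : ℤ, ∀ (H : BGraph t) (ℓ : ℤ),
    HasCycleGE (glue G₁ H) ℓ ↔ HasCycleGE (glue G₂ H) (ℓ + Δ)

namespace LCFII

def CycSet {W : Type} (C : SimpleGraph W) (n : ℕ) : Prop :=
  C.IsCycles ∧ (∀ u ∈ C.support, ∀ v ∈ C.support, C.Reachable u v) ∧
    C.support.ncard = n ∧ C.support.Nonempty

lemma cyc_verts {W : Type} {K : SimpleGraph W} {u : W} (p : K.Walk u u)
    (hp : p.IsCycle) : p.toSubgraph.verts.ncard = p.length := by
  classical
  have h1 : p.toSubgraph.verts = ((p.support.tail.toFinset : Finset W) : Set W) := by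
    ext x
    rw [SimpleGraph.Walk.mem_verts_toSubgraph]
    simp only [List.coe_toFinset, Set.mem_ofPred_eq]
    constructor
    · intro h
      rw [SimpleGraph.Walk.mem_support_iff] at h
      rcases h with rfl | h
      · exact SimpleGraph.Walk.end_mem_tail_support hp.not_nil
      · exact h
    · exact List.mem_of_mem_tail
  rw [h1, Set.ncard_coe_finset, List.toFinset_card_of_nodup hp.support_nodup]
  simp

lemma cyc_of_walk {W : Type} {K : SimpleGraph W} {u : W} (p : K.Walk u u)
    (hp : p.IsCycle) : ∃ C ≤ K, CycSet C p.length := by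
  have hs : p.toSubgraph.spanningCoe.support = p.toSubgraph.verts := by
    ext v
    constructor
    · rintro ⟨w, hw⟩
      exact p.toSubgraph.edge_vert hw
    · intro hv
      have h2 := hp.ncard_neighborSet_toSubgraph_eq_two (p.mem_verts_toSubgraph.mp hv)
      have : (p.toSubgraph.neighborSet v).Nonempty := by
        rw [Set.nonempty_iff_ne_empty]; intro h; rw [h] at h2; simp at h2
      obtain ⟨w, hw⟩ := this
      exact ⟨w, hw⟩
  refine ⟨p.toSubgraph.spanningCoe, p.toSubgraph.spanningCoe_le, ?_, ?_, ?_, ?_⟩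
  · exact hp.isCycles_spanningCoe_toSubgraph
  · rw [hs]
    intro a ha b hb
    have := p.toSubgraph_connected ⟨a, ha⟩ ⟨b, hb⟩
    exact this.map (⟨Subtype.val, fun h => h⟩ : p.toSubgraph.coe →g p.toSubgraph.spanningCoe)
  · rw [hs, cyc_verts p hp]
  · rw [hs]; exact ⟨u, p.start_mem_verts_toSubgraph⟩

lemma walk_of_cyc {W : Type} [Finite W] {K C : SimpleGraph W} {n : ℕ} (h : C ≤ K)
    (hC : CycSet C n) : ∃ (u : W) (p : K.Walk u u), p.IsCycle ∧ p.length = n := by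
  obtain ⟨h1, h2, h3, u, hu⟩ := hC
  have hn : (C.neighborSet u).Nonempty := hu
  obtain ⟨p, hp, hv⟩ := h1.exists_cycle_toSubgraph_verts_eq_connectedComponentSupp
    (c := C.connectedComponentMk u) (v := u) rfl hn
  refine ⟨u, p.mapLe h, hp.mapLe h, ?_⟩
  rw [SimpleGraph.Walk.length_map, ← cyc_verts p hp, hv, ← h3]
  congr 1
  ext v
  simp only [SimpleGraph.ConnectedComponent.mem_supp_iff, SimpleGraph.ConnectedComponent.eq]
  constructor
  · intro hr
    rcases eq_or_ne v u with rfl | hne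
    · exact hu
    · obtain ⟨q⟩ := hr
      cases q with
      | nil => exact absurd rfl hne
      | cons hadj _ => exact ⟨_, hadj⟩
  · intro hv'
    exact h2 _ hv' _ hu

/-- embedding of the `H` side -/
abbrev emb {β V : Type} (X : Type) (b : β → V) : β ⊕ X → V ⊕ X := Sum.map b id

def J {β V X : Type} (b : β → V) (A : SimpleGraph V) (B : SimpleGraph (β ⊕ X)) :
    SimpleGraph (V ⊕ X) := A.map Sum.inl ⊔ B.map (emb X b)

lemma emb_inj {β V X : Type} {b : β → V} (hb : b.Injective) : (emb X b).Injective :=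
  Sum.map_injective.mpr ⟨hb, Function.injective_id⟩

lemma mapAdj {V W : Type} {f : V → W} (hf : f.Injective) (A : SimpleGraph V) (w w' : W) :
    (A.map f).Adj w w' ↔ ∃ u v, A.Adj u v ∧ f u = w ∧ f v = w' := by
  constructor
  · rintro ⟨_, u, v, h, h1, h2⟩
    exact ⟨u, v, h, h1, h2⟩
  · rintro ⟨u, v, h, rfl, rfl⟩
    exact ⟨fun h' => h.ne (hf h'), u, v, h, rfl, rfl⟩

lemma J_adj {β V X : Type} {b : β → V} (hb : b.Injective) (A : SimpleGraph V)
    (B : SimpleGraph (β ⊕ X)) (w w' : V ⊕ X) : (J b A B).Adj w w' ↔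
      (∃ u v, A.Adj u v ∧ Sum.inl u = w ∧ Sum.inl v = w') ∨
      (∃ x y, B.Adj x y ∧ emb X b x = w ∧ emb X b y = w') := by
  rw [J, SimpleGraph.sup_adj, mapAdj Sum.inl_injective, mapAdj (emb_inj hb)]

lemma emb_eq_inl {β V X : Type} {b : β → V} {x : β ⊕ X} {v : V}
    (h : emb X b x = Sum.inl v) : ∃ i, x = Sum.inl i ∧ v = b i := by
  rcases x with i | x
  · exact ⟨i, rfl, by simpa [emb] using h.symm⟩
  · simp [emb] at h

/-- The glued graph as a `J`. -/
lemma glue_eq {t : ℕ} (G H : BGraph t) : glue G H =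
    J G.b G.G (H.G.comap (Sum.elim H.b Subtype.val :
      Fin t ⊕ {v : H.V // v ∉ Set.range H.b} → H.V)) := by
  ext w w'
  rw [J_adj G.binj, glue, SimpleGraph.fromRel_adj]
  constructor
  · rintro ⟨hne, h⟩
    rcases w with u | x <;> rcases w' with v | y
    · have : G.G.Adj u v ∨ ∃ i j, u = G.b i ∧ v = G.b j ∧ H.G.Adj (H.b i) (H.b j) := by
        rcases h with h | h
        · exact h
        · rcases h with h | ⟨i, j, h1, h2, h3⟩
          · exact Or.inl h.symm
          · exact Or.inr ⟨j, i, h2, h1, h3.symm⟩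
      clear h
      rcases this with h | ⟨i, j, rfl, rfl, h⟩
      · exact Or.inl ⟨u, v, h, rfl, rfl⟩
      · exact Or.inr ⟨Sum.inl i, Sum.inl j, h, rfl, rfl⟩
    · rcases h with ⟨i, rfl, h⟩ | h
      · exact Or.inr ⟨Sum.inl i, Sum.inr y, h, rfl, rfl⟩
      · exact h.elim
    · rcases h with h | ⟨i, rfl, h⟩
      · exact h.elim
      · exact Or.inr ⟨Sum.inr x, Sum.inl i, h.symm, rfl, rfl⟩
    · have h : H.G.Adj x.1 y.1 := by
        rcases h with h | h
        · exact h
        · exact SimpleGraph.Adj.symm h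
      exact Or.inr ⟨Sum.inr x, Sum.inr y, h, rfl, rfl⟩
  · rintro (⟨u, v, h, rfl, rfl⟩ | ⟨x, y, h, rfl, rfl⟩)
    · exact ⟨fun h' => h.ne (Sum.inl_injective h'), Or.inl (Or.inl h)⟩
    · refine ⟨fun h' => h.ne (emb_inj G.binj h'), ?_⟩
      rcases x with i | x <;> rcases y with j | y
      · exact Or.inl (Or.inr ⟨i, j, rfl, rfl, h⟩)
      · exact Or.inl ⟨i, rfl, h⟩
      · exact Or.inr ⟨j, rfl, SimpleGraph.Adj.symm h⟩
      · exact Or.inl h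

section
variable {β V V' X : Type}

def Dis (b : β → V) (A : SimpleGraph V) (B : SimpleGraph (β ⊕ X)) : Prop :=
  ∀ i j, A.Adj (b i) (b j) → ¬ B.Adj (Sum.inl i) (Sum.inl j)

lemma decomp {b : β → V} (hb : b.Injective) {G : SimpleGraph V} {Ht : SimpleGraph (β ⊕ X)}
    {C : SimpleGraph (V ⊕ X)} (hC : C ≤ J b G Ht) :
    ∃ A ≤ G, ∃ B ≤ Ht, J b A B = C ∧ Dis b A B := by
  refine ⟨C.comap Sum.inl ⊓ G, inf_le_right,
    (C \ (C.comap Sum.inl ⊓ G).map Sum.inl).comap (emb X b), ?_, ?_, ?_⟩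
  · intro x y h
    obtain ⟨h1, h2⟩ := h
    rcases (J_adj hb _ _ _ _).1 (hC h1) with ⟨u, v, h, hu, hv⟩ | ⟨x', y', h, hx, hy⟩
    · exfalso
      apply h2
      rw [mapAdj Sum.inl_injective]
      refine ⟨u, v, ⟨?_, h⟩, hu, hv⟩
      rw [SimpleGraph.comap_adj, hu, hv]; exact h1
    · rw [emb_inj hb hx, emb_inj hb hy] at h
      exact h
  · ext w w'
    rw [J_adj hb]
    constructor
    · rintro (⟨u, v, h, rfl, rfl⟩ | ⟨x, y, h, rfl, rfl⟩)
      · exact h.1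
      · exact h.1
    · intro h1
      by_cases h2 : ((C.comap Sum.inl ⊓ G).map Sum.inl).Adj w w'
      · exact Or.inl ((mapAdj Sum.inl_injective _ _ _).1 h2)
      · right
        rcases (J_adj hb _ _ _ _).1 (hC h1) with ⟨u, v, h, hu, hv⟩ | ⟨x', y', h, rfl, rfl⟩
        · exfalso
          apply h2
          rw [mapAdj Sum.inl_injective]
          refine ⟨u, v, ⟨?_, h⟩, hu, hv⟩
          rw [SimpleGraph.comap_adj, hu, hv]; exact h1
        · exact ⟨x', y', ⟨h1, h2⟩, rfl, rfl⟩
  · rintro i j h ⟨h1, h2⟩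
    apply h2
    rw [mapAdj Sum.inl_injective]
    exact ⟨b i, b j, h, rfl, rfl⟩

lemma isCycles_iff {W : Type} [Finite W] (C : SimpleGraph W) :
    C.IsCycles ↔ ∀ v, (C.neighborSet v).ncard = 0 ∨ (C.neighborSet v).ncard = 2 := by
  constructor
  · intro h v
    rcases (C.neighborSet v).eq_empty_or_nonempty with h0 | h0
    · left; rw [h0]; simp
    · right; exact h h0
  · intro h v hv
    rcases h v with h0 | h0
    · rw [Set.ncard_eq_zero (Set.toFinite _)] at h0
      exact absurd h0 hv.ne_empty
    · exact h0

lemma nbr_int {b : β → V} (hb : b.Injective) (A : SimpleGraph V) (B : SimpleGraph (β ⊕ X))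
    {v : V} (hv : v ∉ Set.range b) :
    (J b A B).neighborSet (Sum.inl v) = Sum.inl '' A.neighborSet v := by
  ext w
  rw [SimpleGraph.mem_neighborSet, J_adj hb]
  constructor
  · rintro (⟨u, u', h, hu, rfl⟩ | ⟨x, y, h, hx, rfl⟩)
    · cases Sum.inl_injective hu
      exact ⟨u', h, rfl⟩
    · obtain ⟨i, rfl, rfl⟩ := emb_eq_inl hx
      exact absurd ⟨i, rfl⟩ hv
  · rintro ⟨u, h, rfl⟩
    exact Or.inl ⟨v, u, h, rfl, rfl⟩

lemma nbr_bd {b : β → V} (hb : b.Injective) (A : SimpleGraph V) (B : SimpleGraph (β ⊕ X))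
    (i : β) : (J b A B).neighborSet (Sum.inl (b i)) =
      Sum.inl '' A.neighborSet (b i) ∪ emb X b '' B.neighborSet (Sum.inl i) := by
  ext w
  rw [SimpleGraph.mem_neighborSet, J_adj hb]
  constructor
  · rintro (⟨u, u', h, hu, rfl⟩ | ⟨x, y, h, hx, rfl⟩)
    · cases Sum.inl_injective hu
      exact Or.inl ⟨u', h, rfl⟩
    · obtain ⟨j, rfl, hj⟩ := emb_eq_inl hx
      cases hb hj
      exact Or.inr ⟨y, h, rfl⟩
  · rintro (⟨u, h, rfl⟩ | ⟨u, h, rfl⟩)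
    · exact Or.inl ⟨_, u, h, rfl, rfl⟩
    · exact Or.inr ⟨_, u, h, rfl, rfl⟩

lemma nbr_out {b : β → V} (hb : b.Injective) (A : SimpleGraph V) (B : SimpleGraph (β ⊕ X))
    (x : X) : (J b A B).neighborSet (Sum.inr x) = emb X b '' B.neighborSet (Sum.inr x) := by
  ext w
  rw [SimpleGraph.mem_neighborSet, J_adj hb]
  constructor
  · rintro (⟨u, u', h, hu, rfl⟩ | ⟨x', y, h, hx, rfl⟩)
    · cases hu
    · have : x' = Sum.inr x := emb_inj hb hx
      subst this
      exact ⟨y, h, rfl⟩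
  · rintro ⟨u, h, rfl⟩
    exact Or.inr ⟨_, u, h, rfl, rfl⟩

lemma ncard_bd [Finite V] [Finite X] [Finite β] {b : β → V} (hb : b.Injective)
    {A : SimpleGraph V} {B : SimpleGraph (β ⊕ X)} (hd : Dis b A B)
    (i : β) : ((J b A B).neighborSet (Sum.inl (b i))).ncard =
      (A.neighborSet (b i)).ncard + (B.neighborSet (Sum.inl i)).ncard := by
  rw [nbr_bd hb, Set.ncard_union_eq, Set.ncard_image_of_injective _ Sum.inl_injective,
    Set.ncard_image_of_injective _ (emb_inj hb)]
  rw [Set.disjoint_left]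
  rintro _ ⟨v, hv, rfl⟩ ⟨y, hy, h⟩
  obtain ⟨j, rfl, rfl⟩ := emb_eq_inl h
  exact hd i j hv hy

structure Sim (b : β → V) (b' : β → V') (A : SimpleGraph V) (A' : SimpleGraph V') : Prop where
  adj : ∀ i j, A.Adj (b i) (b j) ↔ A'.Adj (b' i) (b' j)
  reach : ∀ i j, A.Reachable (b i) (b j) ↔ A'.Reachable (b' i) (b' j)
  deg : ∀ i, (A.neighborSet (b i)).ncard = (A'.neighborSet (b' i)).ncard
  size : (A.support \ Set.range b).ncard = (A'.support \ Set.range b').ncard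

structure Good (b : β → V) (A : SimpleGraph V) : Prop where
  int : ∀ v ∉ Set.range b, (A.neighborSet v).ncard = 0 ∨ (A.neighborSet v).ncard = 2
  anchored : ∀ v ∈ A.support, ∃ i, A.Reachable v (b i)
  degle : ∀ v, (A.neighborSet v).ncard ≤ 2

lemma mapReach {A : SimpleGraph V} {u : V} {w : V ⊕ X}
    (h : (A.map (Sum.inl : V → V ⊕ X)).Reachable (Sum.inl u) w) :
    ∃ v, w = Sum.inl v ∧ A.Reachable u v := by
  rw [SimpleGraph.reachable_iff_reflTransGen] at h
  induction h with
  | refl => exact ⟨u, rfl, SimpleGraph.Reachable.refl _⟩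
  | tail _ h ih =>
    obtain ⟨v, rfl, hv⟩ := ih
    obtain ⟨a, c, h, ha, rfl⟩ := (mapAdj Sum.inl_injective _ _ _).1 h
    cases Sum.inl_injective ha
    exact ⟨c, rfl, hv.trans h.reachable⟩

lemma mapReach' {A : SimpleGraph V} {x : X} {w : V ⊕ X}
    (h : (A.map (Sum.inl : V → V ⊕ X)).Reachable (Sum.inr x) w) : w = Sum.inr x := by
  rw [SimpleGraph.reachable_iff_reflTransGen] at h
  induction h with
  | refl => rfl
  | tail _ h ih =>
    subst ih
    obtain ⟨a, c, h, ha, rfl⟩ := (mapAdj Sum.inl_injective _ _ _).1 h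
    cases ha

lemma J_reach_A {b : β → V} (hb : b.Injective) {A : SimpleGraph V} {B : SimpleGraph (β ⊕ X)}
    {u v : V} (h : A.Reachable u v) : (J b A B).Reachable (Sum.inl u) (Sum.inl v) :=
  h.map (⟨Sum.inl, fun {a c} h => (J_adj hb _ _ _ _).2 (Or.inl ⟨a, c, h, rfl, rfl⟩)⟩ :
    A →g J b A B)

lemma transferA {b : β → V} {b' : β → V'} (hb : b.Injective) (hb' : b'.Injective)
    {A : SimpleGraph V} {A' : SimpleGraph V'} (B : SimpleGraph (β ⊕ X)) (hs : Sim b b' A A')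
    {x y : β ⊕ X}
    (h : (A.map (Sum.inl : V → V ⊕ X)).Reachable (emb X b x) (emb X b y)) :
    (J b' A' B).Reachable (emb X b' x) (emb X b' y) := by
  rcases x with i | x
  · obtain ⟨v, hv, hr⟩ := mapReach h
    obtain ⟨j, rfl, rfl⟩ := emb_eq_inl hv
    exact J_reach_A hb' ((hs.reach i j).1 hr)
  · have h' := mapReach' h
    have : y = Sum.inr x := emb_inj hb h'
    subst this
    exact SimpleGraph.Reachable.refl _

lemma transferJ {b : β → V} {b' : β → V'} (hb : b.Injective) (hb' : b'.Injective)
    {A : SimpleGraph V} {A' : SimpleGraph V'} (B : SimpleGraph (β ⊕ X)) (hs : Sim b b' A A')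
    {x y : β ⊕ X} (h : (J b A B).Reachable (emb X b x) (emb X b y)) :
    (J b' A' B).Reachable (emb X b' x) (emb X b' y) := by
  have key : ∀ w, (J b A B).Reachable (emb X b x) w → ∃ z,
      (J b' A' B).Reachable (emb X b' x) (emb X b' z) ∧
      (A.map (Sum.inl : V → V ⊕ X)).Reachable (emb X b z) w := by
    intro w h
    rw [SimpleGraph.reachable_iff_reflTransGen] at h
    induction h with
    | refl => exact ⟨x, SimpleGraph.Reachable.refl _, SimpleGraph.Reachable.refl _⟩
    | tail _ h ih =>
      obtain ⟨z, h1, h2⟩ := ih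
      rcases h with h | h
      · exact ⟨z, h1, h2.trans (SimpleGraph.Adj.reachable h)⟩
      · obtain ⟨p, q, hpq, rfl, rfl⟩ := (mapAdj (emb_inj hb) _ _ _).1 h
        refine ⟨q, ?_, SimpleGraph.Reachable.refl _⟩
        refine (h1.trans (transferA hb hb' B hs h2)).trans (SimpleGraph.Adj.reachable ?_)
        exact (J_adj hb' _ _ _ _).2 (Or.inr ⟨p, q, hpq, rfl, rfl⟩)
  obtain ⟨z, h1, h2⟩ := key _ h
  exact h1.trans (transferA hb hb' B hs h2)

lemma supp_iff {W : Type} [Finite W] (C : SimpleGraph W) (v : W) :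
    v ∈ C.support ↔ (C.neighborSet v).ncard ≠ 0 := by
  rw [Ne, Set.ncard_eq_zero (Set.toFinite _), ← Ne, ← Set.nonempty_iff_ne_empty]
  rfl

lemma supp_emb [Finite V] [Finite V'] [Finite X] [Finite β] {b : β → V} {b' : β → V'}
    (hb : b.Injective) (hb' : b'.Injective)
    {A : SimpleGraph V} {A' : SimpleGraph V'} {B : SimpleGraph (β ⊕ X)} (hs : Sim b b' A A')
    (hd : Dis b A B) (hd' : Dis b' A' B) (x : β ⊕ X) :
    ((J b A B).neighborSet (emb X b x)).ncard = ((J b' A' B).neighborSet (emb X b' x)).ncard := by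
  rcases x with i | x
  · change ((J b A B).neighborSet (Sum.inl (b i))).ncard =
      ((J b' A' B).neighborSet (Sum.inl (b' i))).ncard
    rw [ncard_bd hb hd, ncard_bd hb' hd', hs.deg]
  · change ((J b A B).neighborSet (Sum.inr x)).ncard =
      ((J b' A' B).neighborSet (Sum.inr x)).ncard
    rw [nbr_out hb, nbr_out hb', Set.ncard_image_of_injective _ (emb_inj hb),
      Set.ncard_image_of_injective _ (emb_inj hb')]

lemma supp_card [Finite V] [Finite X] [Finite β] {b : β → V} (hb : b.Injective)
    (A : SimpleGraph V) (B : SimpleGraph (β ⊕ X)) : (J b A B).support.ncard =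
      (A.support \ Set.range b).ncard + {x | emb X b x ∈ (J b A B).support}.ncard := by
  rw [← Set.ncard_image_of_injective (A.support \ Set.range b) (Sum.inl_injective (β := X)),
    ← Set.ncard_image_of_injective {x | emb X b x ∈ (J b A B).support} (emb_inj hb),
    ← Set.ncard_union_eq]
  · congr 1
    ext w
    constructor
    · intro hw
      rcases w with v | x
      · by_cases hv : v ∈ Set.range b
        · obtain ⟨i, rfl⟩ := hv
          exact Or.inr ⟨Sum.inl i, hw, rfl⟩
        · left
          refine ⟨v, ⟨?_, hv⟩, rfl⟩
          have : ((J b A B).neighborSet (Sum.inl v)).Nonempty := hw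
          rw [nbr_int hb _ _ hv] at this
          exact Set.image_nonempty.1 this
      · exact Or.inr ⟨Sum.inr x, hw, rfl⟩
    · rintro (⟨v, ⟨⟨u, hu⟩, _⟩, rfl⟩ | ⟨x, hx, rfl⟩)
      · exact ⟨Sum.inl u, (J_adj hb _ _ _ _).2 (Or.inl ⟨v, u, hu, rfl, rfl⟩)⟩
      · exact hx
  · rw [Set.disjoint_left]
    rintro _ ⟨v, hv, rfl⟩ ⟨y, hy, h⟩
    obtain ⟨j, rfl, rfl⟩ := emb_eq_inl h
    exact hv.2 ⟨j, rfl⟩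

lemma replace_cyc [Finite V] [Finite V'] [Finite X] [Finite β] {b : β → V} {b' : β → V'}
    (hb : b.Injective) (hb' : b'.Injective)
    {A : SimpleGraph V} {A' : SimpleGraph V'} {B : SimpleGraph (β ⊕ X)} (hs : Sim b b' A A')
    (hd : Dis b A B) (hg : Good b' A') {n : ℕ} (hB : ∃ x y, B.Adj x y)
    (hC : CycSet (J b A B) n) : CycSet (J b' A' B) n := by
  have hd' : Dis b' A' B := fun i j h => hd i j ((hs.adj i j).2 h)
  have hse := supp_emb hb hb' hs hd hd'
  obtain ⟨h1, h2, h3, h4⟩ := hC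
  have hsm : ∀ x, emb X b x ∈ (J b A B).support ↔ emb X b' x ∈ (J b' A' B).support := by
    intro x
    rw [supp_iff, supp_iff, hse]
  refine ⟨?_, ?_, ?_, ?_⟩
  · rw [isCycles_iff] at h1 ⊢
    intro w
    rcases w with v | x
    · by_cases hv : v ∈ Set.range b'
      · obtain ⟨i, rfl⟩ := hv
        have := h1 (emb X b (Sum.inl i))
        rw [hse] at this
        exact this
      · rw [nbr_int hb' _ _ hv, Set.ncard_image_of_injective _ Sum.inl_injective]
        exact hg.int v hv
    · have := h1 (emb X b (Sum.inr x))
      rw [hse] at this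
      exact this
  · have key : ∀ w ∈ (J b' A' B).support, ∃ x, emb X b x ∈ (J b A B).support ∧
        (J b' A' B).Reachable w (emb X b' x) := by
      intro w hw
      rcases w with v | x
      · by_cases hv : v ∈ Set.range b'
        · obtain ⟨i, rfl⟩ := hv
          exact ⟨Sum.inl i, (hsm _).2 hw, SimpleGraph.Reachable.refl _⟩
        · have hn : ((J b' A' B).neighborSet (Sum.inl v)).Nonempty := hw
          rw [nbr_int hb' _ _ hv] at hn
          obtain ⟨i, hi⟩ := hg.anchored v (Set.image_nonempty.1 hn)
          refine ⟨Sum.inl i, (hsm _).2 ?_, J_reach_A hb' hi⟩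
          have hne : v ≠ b' i := fun h => hv ⟨i, h.symm⟩
          obtain ⟨q⟩ := hi.symm
          cases q with
          | nil => exact absurd rfl hne
          | cons hadj _ =>
            exact ⟨_, (J_adj hb' _ _ _ _).2 (Or.inl ⟨_, _, hadj, rfl, rfl⟩)⟩
      · exact ⟨Sum.inr x, (hsm (Sum.inr x)).2 hw, SimpleGraph.Reachable.refl _⟩
    intro w hw w' hw'
    obtain ⟨x, hx, hx'⟩ := key w hw
    obtain ⟨y, hy, hy'⟩ := key w' hw'
    exact (hx'.trans (transferJ hb hb' B hs (h2 _ hx _ hy))).trans hy'.symm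
  · rw [← h3, supp_card hb, supp_card hb', hs.size]
    simp only [hsm]
  · obtain ⟨x, y, h⟩ := hB
    exact ⟨emb X b' x, emb X b' y, (J_adj hb' _ _ _ _).2 (Or.inr ⟨x, y, h, rfl, rfl⟩)⟩

lemma good_of_cyc [Finite V] [Finite X] [Finite β] {b : β → V}
    (hb : b.Injective) {A : SimpleGraph V} {B : SimpleGraph (β ⊕ X)}
    {n : ℕ} (hB : ∃ x y, B.Adj x y) (hC : CycSet (J b A B) n) : Good b A := by
  obtain ⟨h1, h2, h3, h4⟩ := hC
  rw [isCycles_iff] at h1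
  refine ⟨?_, ?_, ?_⟩
  · intro v hv
    have := h1 (Sum.inl v)
    rwa [nbr_int hb _ _ hv, Set.ncard_image_of_injective _ Sum.inl_injective] at this
  · intro v hv
    obtain ⟨x, y, hxy⟩ := hB
    have hr : (J b A B).Reachable (Sum.inl v) (emb X b x) := by
      apply h2
      · obtain ⟨u, hu⟩ := hv
        exact ⟨Sum.inl u, (J_adj hb _ _ _ _).2 (Or.inl ⟨v, u, hu, rfl, rfl⟩)⟩
      · exact ⟨emb X b y, (J_adj hb _ _ _ _).2 (Or.inr ⟨x, y, hxy, rfl, rfl⟩)⟩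
    have key : ∀ w, (J b A B).Reachable (Sum.inl v) w → (∃ i, A.Reachable v (b i)) ∨
        ∃ v', w = Sum.inl v' ∧ A.Reachable v v' := by
      intro w hw
      rw [SimpleGraph.reachable_iff_reflTransGen] at hw
      induction hw with
      | refl => exact Or.inr ⟨v, rfl, SimpleGraph.Reachable.refl _⟩
      | tail _ h ih =>
        rcases ih with ih | ⟨v', rfl, hv'⟩
        · exact Or.inl ih
        · rcases (J_adj hb _ _ _ _).1 h with ⟨p, q, h, hp, rfl⟩ | ⟨p, q, h, hp, rfl⟩
          · cases Sum.inl_injective hp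
            exact Or.inr ⟨q, rfl, hv'.trans h.reachable⟩
          · obtain ⟨i, rfl, rfl⟩ := emb_eq_inl hp
            exact Or.inl ⟨i, hv'⟩
    rcases key _ hr with h | ⟨v', h, hv'⟩
    · exact h
    · obtain ⟨i, rfl, rfl⟩ := emb_eq_inl h
      exact ⟨i, hv'⟩
  · intro v
    have h5 : (A.neighborSet v).ncard ≤ ((J b A B).neighborSet (Sum.inl v)).ncard := by
      rw [← Set.ncard_image_of_injective _ (Sum.inl_injective (β := X))]
      apply Set.ncard_le_ncard _ (Set.toFinite _)
      rintro _ ⟨u, hu, rfl⟩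
      exact (J_adj hb _ _ _ _).2 (Or.inl ⟨v, u, hu, rfl, rfl⟩)
    have := h1 (Sum.inl v)
    omega

end

section td
variable {V : Type}

def Anc (par : V → V) (u w : V) : Prop := ∃ n, par^[n] w = u

lemma anc_dep {par : V → V} {dep : V → ℕ}
    (hp : ∀ v, (par v = v → dep v = 1) ∧ (par v ≠ v → dep v = dep (par v) + 1))
    {u w : V} (h : Anc par u w) : u = w ∨ dep u < dep w := by
  obtain ⟨n, rfl⟩ := h
  induction n with
  | zero => exact Or.inl rfl
  | succ n ih =>
    rw [Function.iterate_succ_apply']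
    by_cases hv : par (par^[n] w) = par^[n] w
    · rw [hv]; exact ih
    · right
      have := (hp _).2 hv
      rcases ih with ih | ih
      · rw [ih] at this ⊢; omega
      · omega

lemma anc_trans {par : V → V} {u v w : V} (h : Anc par u v) (h' : Anc par v w) :
    Anc par u w := by
  obtain ⟨n, rfl⟩ := h
  obtain ⟨m, rfl⟩ := h'
  exact ⟨n + m, by rw [Function.iterate_add_apply]⟩

lemma anc_comp {par : V → V} {u v w : V} (h : Anc par u w) (h' : Anc par v w) :
    Anc par u v ∨ Anc par v u := by
  obtain ⟨n, rfl⟩ := h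
  obtain ⟨m, rfl⟩ := h'
  rcases le_total n m with hnm | hnm
  · right
    exact ⟨m - n, by rw [← Function.iterate_add_apply]; congr 2; omega⟩
  · left
    exact ⟨n - m, by rw [← Function.iterate_add_apply]; congr 2; omega⟩

lemma chain_desc {par : V → V} {dep : V → ℕ}
    (hp : ∀ v, (par v = v → dep v = 1) ∧ (par v ≠ v → dep v = dep (par v) + 1))
    {m : V} (l : List V) : ∀ a, Anc par m a →
    (a :: l).IsChain (fun u w => Anc par u w ∨ Anc par w u) → (∀ x ∈ l, dep m ≤ dep x) →
    ∀ x ∈ l, Anc par m x := by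
  induction l with
  | nil => intro a _ _ _ x hx; cases hx
  | cons y l ih =>
    intro a ha hc hm
    rw [List.isChain_cons_cons] at hc
    have hy : Anc par m y := by
      rcases hc.1 with h | h
      · exact anc_trans ha h
      · rcases anc_comp ha h with h' | h'
        · exact h'
        · rcases anc_dep hp h' with rfl | h''
          · exact ⟨0, rfl⟩
          · have := hm y (by simp)
            omega
    intro x hx
    rcases List.mem_cons.1 hx with rfl | hx
    · exact hy
    · exact ih y hy hc.2 (fun z hz => hm z (by simp [hz])) x hx

lemma path_bound {par : V → V} {dep : V → ℕ}
    (hp : ∀ v, (par v = v → dep v = 1) ∧ (par v ≠ v → dep v = dep (par v) + 1))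
    (h k : ℕ) : ∀ l : List V, l.Nodup →
    l.IsChain (fun u w => Anc par u w ∨ Anc par w u) →
    (∀ x ∈ l, dep x ≤ h ∧ h < dep x + k) → l.length < 2 ^ k := by
  induction k with
  | zero =>
    intro l _ _ hl
    cases l with
    | nil => simp
    | cons x l => have := hl x (by simp); omega
  | succ k ih =>
    intro l hn hc hl
    rcases eq_or_ne l [] with rfl | hne
    · simp
    · obtain ⟨m, hm, hmin⟩ : ∃ m ∈ l, ∀ x ∈ l, dep m ≤ dep x := by
        classical
        obtain ⟨m, hm, h⟩ := Finset.exists_min_image l.toFinset dep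
          (by simpa using hne)
        exact ⟨m, by simpa using hm, fun x hx => h x (by simpa using hx)⟩
      obtain ⟨l1, l2, rfl⟩ := List.append_of_mem hm
      have hc2 : (m :: l2).IsChain (fun u w => Anc par u w ∨ Anc par w u) :=
        hc.right_of_append
      have hc1 : (m :: l1.reverse).IsChain (fun u w => Anc par u w ∨ Anc par w u) := by
        have hc' : ((l1 ++ [m]) ++ l2).IsChain (fun u w => Anc par u w ∨ Anc par w u) := by
          simpa using hc
        have := hc'.left_of_append
        rw [← List.isChain_reverse] at this
        simp only [List.reverse_append, List.reverse_cons, List.reverse_nil, List.nil_append,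
          List.singleton_append] at this
        exact this.imp (fun _ _ h => h.symm)
      have hd2 := chain_desc hp l2 m ⟨0, rfl⟩ hc2 (fun x hx => hmin x (by simp [hx]))
      have hd1 := chain_desc hp l1.reverse m ⟨0, rfl⟩ hc1
        (fun x hx => hmin x (by simp at hx; simp [hx]))
      have hmm := hl m hm
      have hnd := List.nodup_middle.1 hn
      rw [List.nodup_cons] at hnd
      have aux : ∀ x, x ∈ l1 ++ l2 → Anc par m x → dep x ≤ h ∧ h < dep x + k := by
        intro x hx ha
        have h1 := hl x (by simp at hx ⊢; tauto)
        rcases anc_dep hp ha with rfl | h2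
        · exact absurd hx hnd.1
        · omega
      have b1 := ih l1 (List.nodup_append.1 hn).1 hc.left_of_append
        (fun x hx => aux x (by simp [hx]) (hd1 x (by simp [hx])))
      have b2 := ih l2 (List.nodup_append.1 hnd.2).2.1 hc2.tail
        (fun x hx => aux x (by simp [hx]) (hd2 x hx))
      simp only [List.length_append, List.length_cons, pow_succ]
      omega

lemma td_list {G : SimpleGraph V} {d : ℕ} (hG : treedepthLE G d) {l : List V}
    (hn : l.Nodup) (hc : l.IsChain G.Adj) : l.length < 2 ^ d := by
  obtain ⟨par, dep, hp, hd, ha⟩ := hG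
  refine path_bound hp d d l hn (hc.imp (fun u w h => ha u w h)) (fun x _ => ⟨hd x, ?_⟩)
  have : 1 ≤ dep x := by
    by_cases h : par x = x
    · rw [(hp x).1 h]
    · rw [(hp x).2 h]; omega
  omega

lemma td_cycle {G : SimpleGraph V} {d : ℕ} (hG : treedepthLE G d) {u : V} (p : G.Walk u u)
    (hp : p.IsCycle) : p.length < 2 ^ d := by
  have := td_list hG hp.support_nodup p.isChain_adj_support.tail
  simpa using this

lemma td_path {G : SimpleGraph V} {d : ℕ} (hG : treedepthLE G d) {u v : V} (p : G.Walk u v)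
    (hp : p.IsPath) : p.length < 2 ^ d := by
  have := td_list hG hp.support_nodup p.isChain_adj_support
  simp at this
  omega

lemma ball_bound [Finite V] {t : ℕ} (b : Fin t → V) (A : SimpleGraph V)
    (hA : ∀ v, (A.neighborSet v).ncard ≤ 2) (n : ℕ) :
    {v | ∃ i, ∃ p : A.Walk v (b i), p.length ≤ n}.ncard ≤ t * 3 ^ n := by
  classical
  have := Fintype.ofFinite V
  induction n with
  | zero =>
    have h : {v | ∃ i, ∃ p : A.Walk v (b i), p.length ≤ 0} ⊆ b '' Set.univ := by
      rintro v ⟨i, p, hp⟩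
      cases p with
      | nil => exact ⟨i, trivial, rfl⟩
      | cons h p => simp at hp
    refine (Set.ncard_le_ncard h (Set.toFinite _)).trans ?_
    refine (Set.ncard_image_le (Set.toFinite _)).trans ?_
    simp
  | succ n ih =>
    set S := {v | ∃ i, ∃ p : A.Walk v (b i), p.length ≤ n} with hS
    have h : {v | ∃ i, ∃ p : A.Walk v (b i), p.length ≤ n + 1} ⊆
        ((S.toFinset.biUnion (fun u => insert u (A.neighborSet u).toFinset) : Finset V) :
          Set V) := by
      rintro v ⟨i, p, hp⟩
      simp only [Finset.coe_biUnion, Set.mem_iUnion]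
      cases p with
      | nil => exact ⟨b i, by simp [hS]; exact ⟨i, SimpleGraph.Walk.nil, by simp⟩, by simp⟩
      | @cons _ u _ h q =>
        refine ⟨u, ?_, ?_⟩
        · simp [hS]
          exact ⟨i, q, by simpa using hp⟩
        · simp [h.symm]
    refine (Set.ncard_le_ncard h (Set.toFinite _)).trans ?_
    rw [Set.ncard_coe_finset]
    refine (Finset.card_biUnion_le_card_mul _ _ 3 ?_).trans ?_
    · intro u _
      refine (Finset.card_insert_le _ _).trans ?_
      have := hA u
      rw [Set.ncard_eq_toFinset_card'] at this
      omega
    · rw [Set.ncard_eq_toFinset_card'] at ih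
      rw [pow_succ]
      nlinarith

lemma size_bound [Finite V] {t d : ℕ} {b : Fin t → V} {G A : SimpleGraph V}
    (hG : treedepthLE G d) (hA : A ≤ G) (hg : Good b A) :
    (A.support \ Set.range b).ncard ≤ t * 3 ^ (2 ^ d) := by
  classical
  refine le_trans (Set.ncard_le_ncard ?_ (Set.toFinite _)) (ball_bound b A hg.degle (2 ^ d))
  rintro v ⟨hv, _⟩
  obtain ⟨i, hi⟩ := hg.anchored v hv
  obtain ⟨p, hp⟩ := hi.exists_isPath
  refine ⟨i, p, ?_⟩
  have := td_path hG (p.mapLe hA) (hp.mapLe hA)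
  simp at this
  omega

end td

abbrev Sg (t : ℕ) : Type :=
  (Fin t → Fin t → Prop) × (Fin t → Fin t → Prop) × (Fin t → ℕ) × ℕ

noncomputable def sg {t : ℕ} {V : Type} (b : Fin t → V) (A : SimpleGraph V) : Sg t :=
  (fun i j => A.Adj (b i) (b j), fun i j => A.Reachable (b i) (b j),
    fun i => (A.neighborSet (b i)).ncard, (A.support \ Set.range b).ncard)

def sig {t : ℕ} (G : BGraph t) : Set (Sg t) × Set ℕ :=
  ({s | ∃ A ≤ G.G, Good G.b A ∧ sg G.b A = s},
    {n | ∃ (u : G.V) (p : G.G.Walk u u), p.IsCycle ∧ p.length = n})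

lemma sim_of_sg {t : ℕ} {V V' : Type} {b : Fin t → V} {b' : Fin t → V'} {A : SimpleGraph V}
    {A' : SimpleGraph V'} (h : sg b A = sg b' A') : Sim b b' A A' := by
  simp only [sg, Prod.mk.injEq] at h
  obtain ⟨h1, h2, h3, h4⟩ := h
  exact ⟨fun i j => iff_of_eq (congrFun (congrFun h1 i) j),
    fun i j => iff_of_eq (congrFun (congrFun h2 i) j), fun i => congrFun h3 i, h4⟩

lemma transfer_cycle {t : ℕ} {G G' : BGraph t} (h : sig G = sig G') (H : BGraph t) (ℓ : ℤ)
    (hc : HasCycleGE (glue G H) ℓ) : HasCycleGE (glue G' H) ℓ := by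
  have := G.fin
  have := G'.fin
  have := H.fin
  obtain ⟨u, p, hp, hl⟩ := hc
  obtain ⟨C, hCle, hC⟩ := cyc_of_walk p hp
  rw [glue_eq] at hCle
  obtain ⟨A, hA, B, hB, rfl, hd⟩ := decomp G.binj hCle
  suffices hs : ∃ (u' : _) (p' : (glue G' H).Walk u' u'), p'.IsCycle ∧ p'.length = p.length by
    obtain ⟨u', p', h1, h2⟩ := hs
    exact ⟨u', p', h1, by rw [h2]; exact hl⟩
  by_cases hne : ∃ x y, B.Adj x y
  · have hg := good_of_cyc G.binj hne hC
    have hmem : sg G.b A ∈ (sig G).1 := ⟨A, hA, hg, rfl⟩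
    rw [h] at hmem
    obtain ⟨A', hA', hg', hs⟩ := hmem
    have hC' := replace_cyc G.binj G'.binj (sim_of_sg hs.symm) hd hg' hne hC
    refine walk_of_cyc ?_ hC'
    rw [glue_eq]
    intro w w' hw
    rw [J_adj G'.binj] at hw ⊢
    rcases hw with ⟨a, c, h, h'⟩ | ⟨a, c, h, h'⟩
    · exact Or.inl ⟨a, c, hA' h, h'⟩
    · exact Or.inr ⟨a, c, hB h, h'⟩
  · have hCA : J G.b A B = A.map Sum.inl := by
      ext w w'
      rw [J_adj G.binj, mapAdj Sum.inl_injective]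
      constructor
      · rintro (h | ⟨x, y, h, _⟩)
        · exact h
        · exact absurd ⟨x, y, h⟩ hne
      · exact Or.inl
    rw [hCA] at hC
    have hsupp : (A.map (Sum.inl : G.V → G.V ⊕ {v : H.V // v ∉ Set.range H.b})).support =
        Sum.inl '' A.support := by
      ext w
      constructor
      · rintro ⟨w', hw⟩
        obtain ⟨a, c, h, rfl, rfl⟩ := (mapAdj Sum.inl_injective _ _ _).1 hw
        exact ⟨a, ⟨c, h⟩, rfl⟩
      · rintro ⟨a, ⟨c, h⟩, rfl⟩
        exact ⟨Sum.inl c, (mapAdj Sum.inl_injective _ _ _).2 ⟨a, c, h, rfl, rfl⟩⟩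
    have hCA' : CycSet A p.length := by
      obtain ⟨h1, h2, h3, h4⟩ := hC
      rw [hsupp] at h2 h3 h4
      refine ⟨?_, ?_, ?_, Set.image_nonempty.1 h4⟩
      · intro v hv
        have e := SimpleGraph.neighborSet_map A
          (Function.Embedding.inl : G.V ↪ G.V ⊕ {v : H.V // v ∉ Set.range H.b}) v
        have h5 := @h1 (Sum.inl v)
        change ((A.map Sum.inl).neighborSet (Sum.inl v)) = Sum.inl '' A.neighborSet v at e
        rw [e, Set.ncard_image_of_injective _ Sum.inl_injective] at h5
        exact h5 (hv.image _)
      · intro a ha c hc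
        obtain ⟨v, hv, hr⟩ := mapReach (h2 _ ⟨a, ha, rfl⟩ _ ⟨c, hc, rfl⟩)
        cases Sum.inl_injective hv
        exact hr
      · rwa [Set.ncard_image_of_injective _ Sum.inl_injective] at h3
    have hmem : p.length ∈ (sig G).2 := walk_of_cyc hA hCA'
    rw [h] at hmem
    obtain ⟨u', q, hq, hql⟩ := hmem
    let f : G'.G →g glue G' H := ⟨Sum.inl, fun {a c} h => by
      rw [glue_eq]; exact (J_adj G'.binj _ _ _ _).2 (Or.inl ⟨a, c, h, rfl, rfl⟩)⟩
    exact ⟨_, q.map f, hq.map (f := f) Sum.inl_injective, by simpa using hql⟩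

lemma sig_finite (t d : ℕ) : (sig '' {G : BGraph t | treedepthLE G.G d}).Finite := by
  have hF : ({s : Sg t | (∀ i, s.2.2.1 i ≤ 2) ∧ s.2.2.2 ≤ t * 3 ^ (2 ^ d)}).Finite := by
    have : (Set.univ ×ˢ (Set.univ ×ˢ ((Set.Iic (fun _ => 2)) ×ˢ Set.Iic (t * 3 ^ (2 ^ d)))) :
        Set (Sg t)).Finite :=
      Set.finite_univ.prod (Set.finite_univ.prod ((Set.finite_Iic _).prod (Set.finite_Iic _)))
    refine this.subset ?_
    rintro s ⟨h1, h2⟩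
    exact ⟨trivial, trivial, h1, h2⟩
  refine ((hF.finite_subsets).prod ((Set.finite_Iio (2 ^ d)).finite_subsets)).subset ?_
  rintro _ ⟨G, hG, rfl⟩
  have := G.fin
  constructor
  · rintro s ⟨A, hA, hg, rfl⟩
    exact ⟨fun i => hg.degle _, size_bound hG hA hg⟩
  · rintro n ⟨u, p, hp, rfl⟩
    exact td_cycle hG p hp

end LCFII

/-- Longest Cycle has finite integer index on graphs of treedepth at most `d`. -/
theorem longestCycle_finite_integer_index (t d : ℕ) :
    ∃ R : Set (BGraph t), R.Finite ∧
      ∀ G : BGraph t, treedepthLE G.G d → ∃ R₀ ∈ R, LCEquiv G R₀ := by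
  obtain ⟨R, hR, hb⟩ := Set.exists_subset_bijOn {G : BGraph t | treedepthLE G.G d} LCFII.sig
  refine ⟨R, ?_, ?_⟩
  · apply Set.Finite.of_finite_image _ hb.injOn
    rw [hb.image_eq]
    exact LCFII.sig_finite t d
  · intro G hG
    obtain ⟨R₀, h0, h1⟩ := hb.surjOn ⟨G, hG, rfl⟩
    refine ⟨R₀, h0, 0, fun H ℓ => ?_⟩
    rw [add_zero]
    exact ⟨LCFII.transfer_cycle h1.symm H ℓ, LCFII.transfer_cycle h1 H ℓ⟩
end
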